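/- For all m ≥ 3, the scramble number of the rook graph K_3 □ K_m equals 2m (and hence equals its gonality). -/

import Mathlib

/-- Decidability of adjacency in a box product of simple graphs. -/
instance {α β : Type*} (G : SimpleGraph α) (H : SimpleGraph β) [DecidableEq α] [DecidableEq β]
    [DecidableRel G.Adj] [DecidableRel H.Adj] : DecidableRel (G □ H).Adj := fun _ _ =>
  decidable_of_iff _ SimpleGraph.boxProd_adj.symm

/-- The degree of a divisor: the sum of its values. -/
def degD {V : Type*} [Fintype V] (D : V → ℤ) : ℤ := ∑ v, D v

/-- A divisor is effective if all its values are nonnegative. -/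
def Effective {V : Type*} (D : V → ℤ) : Prop := ∀ v, 0 ≤ D v

/-- The number of edges from the vertex `v` to the vertex set `A`. -/
def edgesTo {V : Type*} [DecidableEq V] (G : SimpleGraph V) [DecidableRel G.Adj]
    (v : V) (A : Finset V) : ℕ := (A.filter (fun u => G.Adj v u)).card

/-- The divisor obtained from `D` by firing the vertex subset `A`: every vertex of `A`
sends one chip along each edge leaving `A`. -/
def fire {V : Type*} [Fintype V] [DecidableEq V] (G : SimpleGraph V) [DecidableRel G.Adj]
    (D : V → ℤ) (A : Finset V) : V → ℤ :=
  fun v => if v ∈ A then D v - edgesTo G v Aᶜ else D v + edgesTo G v A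

/-- Two divisors are equivalent if one is obtained from the other by a finite
sequence of subset firings. -/
def LinEquiv {V : Type*} [Fintype V] [DecidableEq V] (G : SimpleGraph V) [DecidableRel G.Adj]
    (D D' : V → ℤ) : Prop :=
  Relation.ReflTransGen (fun D₁ D₂ => ∃ A : Finset V, D₂ = fire G D₁ A) D D'

/-- A divisor `D` has rank at least `r` if for every effective divisor `E` of degree `r`,
`D - E` is equivalent to an effective divisor. -/
def RankGE {V : Type*} [Fintype V] [DecidableEq V] (G : SimpleGraph V) [DecidableRel G.Adj]
    (D : V → ℤ) (r : ℕ) : Prop :=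
  ∀ E : V → ℤ, Effective E → degD E = (r : ℤ) →
    ∃ D', LinEquiv G (D - E) D' ∧ Effective D'

/-- The `k`-gonality of a graph: the minimal degree of a divisor of rank at least `k`. -/
noncomputable def kGonality {V : Type*} [Fintype V] [DecidableEq V] (G : SimpleGraph V)
    [DecidableRel G.Adj] (k : ℕ) : ℕ :=
  sInf {d : ℕ | ∃ D : V → ℤ, RankGE G D k ∧ degD D = (d : ℤ)}

/-- The gonality of a graph: the minimal degree of a divisor of rank at least `1`. -/
noncomputable def gonality {V : Type*} [Fintype V] [DecidableEq V] (G : SimpleGraph V)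
    [DecidableRel G.Adj] : ℕ := kGonality G 1

/-- The two-dimensional rook graph `K_n □ K_m`: the box product of the complete graphs
on `n` and `m` vertices. -/
def rook (n m : ℕ) : SimpleGraph (Fin n × Fin m) :=
  (⊤ : SimpleGraph (Fin n)) □ (⊤ : SimpleGraph (Fin m))

instance (n m : ℕ) : DecidableRel (rook n m).Adj := by unfold rook; infer_instance

/-- A scramble on `G`: a collection of nonempty vertex subsets (eggs), each of which
induces a connected subgraph. -/
def IsScramble {V : Type*} (G : SimpleGraph V) (S : Set (Finset V)) : Prop :=
  ∀ E ∈ S, E.Nonempty ∧ (G.induce (E : Set V)).Connected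

/-- A hitting set of a scramble: a vertex set intersecting every egg. -/
def IsHittingSet {V : Type*} [DecidableEq V] (S : Set (Finset V)) (H : Finset V) : Prop :=
  ∀ E ∈ S, (E ∩ H).Nonempty

/-- The number of edges with one endpoint in `X` and the other outside `X`. -/
def cutSize {V : Type*} [Fintype V] [DecidableEq V] (G : SimpleGraph V) [DecidableRel G.Adj]
    (X : Finset V) : ℕ :=
  (Finset.univ.filter (fun p : V × V => G.Adj p.1 p.2 ∧ p.1 ∈ X ∧ p.2 ∉ X)).card

/-- The partition `(X, Xᶜ)` is an egg cut of `S` if some egg is contained in `X` and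
some egg is contained in `Xᶜ`. -/
def IsEggCut {V : Type*} [Fintype V] [DecidableEq V] (S : Set (Finset V)) (X : Finset V) : Prop :=
  (∃ E ∈ S, E ⊆ X) ∧ (∃ E ∈ S, E ⊆ Xᶜ)

/-- The order of a scramble: the minimum of the minimal hitting set size and the minimal
egg cut-set size (`⊤` if no hitting set/egg cut exists). -/
noncomputable def scrambleOrder {V : Type*} [Fintype V] [DecidableEq V] (G : SimpleGraph V)
    [DecidableRel G.Adj] (S : Set (Finset V)) : ℕ∞ :=
  min (sInf {k : ℕ∞ | ∃ H : Finset V, IsHittingSet S H ∧ (H.card : ℕ∞) = k})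
      (sInf {k : ℕ∞ | ∃ X : Finset V, IsEggCut S X ∧ (cutSize G X : ℕ∞) = k})

/-- The scramble number of a graph: the maximum order of a scramble on it. -/
noncomputable def scrambleNumber {V : Type*} [Fintype V] [DecidableEq V] (G : SimpleGraph V)
    [DecidableRel G.Adj] : ℕ∞ :=
  sSup {k : ℕ∞ | ∃ S : Set (Finset V), IsScramble G S ∧ scrambleOrder G S = k}

/-- A connected vertex set meeting `A` and not contained in `A` spans an edge leaving `A`. -/
theorem exists_adj_of_connected {V : Type*} (G : SimpleGraph V) {E A : Finset V}
    (hE : (G.induce (E : Set V)).Connected)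
    {a b : V} (ha : a ∈ E) (haA : a ∈ A) (hb : b ∈ E) (hbA : b ∉ A) :
    ∃ x ∈ E, ∃ y ∈ E, x ∈ A ∧ y ∉ A ∧ G.Adj x y := by
  obtain ⟨p⟩ := hE.preconnected ⟨a, ha⟩ ⟨b, hb⟩
  obtain ⟨d, -, h1, h2⟩ := p.exists_boundary_dart {x | (x : V) ∈ A} haA hbA
  exact ⟨d.fst, d.fst.2, d.snd, d.snd.2, h1, h2, d.adj⟩

theorem edgesTo_pos {V : Type*} [DecidableEq V] (G : SimpleGraph V) [DecidableRel G.Adj]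
    {v u : V} {A : Finset V} (hu : u ∈ A) (h : G.Adj v u) :
    0 < edgesTo G v A :=
  Finset.card_pos.2 ⟨u, Finset.mem_filter.2 ⟨hu, h⟩⟩

section Laplacian

variable {V : Type*} [Fintype V] (G : SimpleGraph V) [DecidableRel G.Adj]

/-- The graph Laplacian applied to an integer-valued function. -/
def laplacian (f : V → ℤ) : V → ℤ := fun v => ∑ u, if G.Adj v u then f v - f u else 0

theorem laplacian_add (f g : V → ℤ) :
    laplacian G (f + g) = laplacian G f + laplacian G g := by
  funext v
  simp only [laplacian, Pi.add_apply, ← Finset.sum_add_distrib]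
  refine Finset.sum_congr rfl fun u _ => ?_
  split_ifs <;> ring

theorem laplacian_const (c : ℤ) : laplacian G (fun _ => c) = 0 := by
  funext v
  simp [laplacian]

theorem sum_laplacian (f : V → ℤ) : ∑ v, laplacian G f v = 0 := by
  have h : ∑ v, laplacian G f v = -∑ v, laplacian G f v := by
    conv_lhs => simp only [laplacian]
    rw [Finset.sum_comm, ← Finset.sum_neg_distrib]
    refine Finset.sum_congr rfl fun v _ => ?_
    rw [laplacian, ← Finset.sum_neg_distrib]
    refine Finset.sum_congr rfl fun u _ => ?_
    simp only [G.adj_comm u v]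
    split_ifs <;> ring
  linarith

theorem degD_sub_laplacian (D f : V → ℤ) : degD (D - laplacian G f) = degD D := by
  simp [degD, sum_laplacian]

/-- Firing `f` level by level, from the top `M` downwards: the divisor after `n` steps. -/
def levelDivisor (D f : V → ℤ) (M : ℤ) (n : ℕ) : V → ℤ :=
  D - laplacian G (fun v => max (f v) (M - n))

theorem levelDivisor_zero {D f : V → ℤ} {M : ℤ} (hM : ∀ v, f v ≤ M) :
    levelDivisor G D f M 0 = D := by
  have h : (fun v => max (f v) (M - (0 : ℕ))) = fun _ => M := by
    funext v
    simp [hM v]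
  rw [levelDivisor, h, laplacian_const, sub_zero]

theorem levelDivisor_of_le {D f : V → ℤ} {M : ℤ} {N : ℕ} (hN : ∀ v, M - N ≤ f v) :
    levelDivisor G D f M N = D - laplacian G f := by
  have h : (fun v => max (f v) (M - N)) = f := by
    funext v
    simp [hN v]
  rw [levelDivisor, h]

theorem levelDivisor_effective {D f : V → ℤ} (hD : Effective D)
    (hf : Effective (D - laplacian G f)) (M : ℤ) (n : ℕ) :
    Effective (levelDivisor G D f M n) := by
  intro v
  rcases le_total (M - n) (f v) with h | h
  · refine (hf v).trans ?_
    simp only [levelDivisor, Pi.sub_apply, laplacian]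
    refine sub_le_sub_left (Finset.sum_le_sum fun u _ => ?_) _
    split_ifs <;> omega
  · refine (hD v).trans ?_
    simp only [levelDivisor, Pi.sub_apply, laplacian]
    rw [le_sub_self_iff]
    refine Finset.sum_nonpos fun u _ => ?_
    split_ifs <;> omega

/-- The vertex set fired in the step from `levelDivisor n` to `levelDivisor (n + 1)`. -/
def levelSet (f : V → ℤ) (M : ℤ) (n : ℕ) : Finset V := Finset.univ.filter fun v => M - n ≤ f v

theorem levelSet_mono (f : V → ℤ) (M : ℤ) : Monotone (levelSet f M) := by
  intro i j hij v hv
  simp only [levelSet, Finset.mem_filter, Finset.mem_univ, true_and] at hv ⊢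
  omega

variable [DecidableEq V]

theorem fire_eq_sub_laplacian (D : V → ℤ) (A : Finset V) :
    fire G D A = D - laplacian G (fun v => if v ∈ A then 1 else 0) := by
  funext v
  by_cases hv : v ∈ A
  · have h : laplacian G (fun v => if v ∈ A then 1 else 0) v = edgesTo G v Aᶜ := by
      rw [laplacian, edgesTo, Finset.card_filter, Nat.cast_sum, ← Finset.sum_subset
        (Finset.subset_univ Aᶜ)]
      · refine Finset.sum_congr rfl fun u hu => ?_
        simp [hv, Finset.mem_compl.1 hu]
      · intro u _ hu
        simp [hv, Finset.notMem_compl.1 hu]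
    simp [fire, hv, h]
  · have h : laplacian G (fun v => if v ∈ A then 1 else 0) v = -edgesTo G v A := by
      rw [laplacian, edgesTo, Finset.card_filter, Nat.cast_sum, ← Finset.sum_neg_distrib,
        ← Finset.sum_subset (Finset.subset_univ A)]
      · refine Finset.sum_congr rfl fun u hu => ?_
        by_cases h : G.Adj v u <;> simp [hv, hu, h]
      · intro u _ hu
        simp [hv, hu]
    simp [fire, hv, h]

theorem LinEquiv.exists_sub_laplacian {D D' : V → ℤ} (h : LinEquiv G D D') :
    ∃ f, D' = D - laplacian G f := by
  induction h with
  | refl => exact ⟨fun _ => 0, by rw [laplacian_const]; simp⟩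
  | tail _ h ih =>
    obtain ⟨f, rfl⟩ := ih
    obtain ⟨A, rfl⟩ := h
    exact ⟨f + fun v => if v ∈ A then 1 else 0, by
      rw [fire_eq_sub_laplacian, laplacian_add, sub_sub]⟩

theorem cutSize_eq_sum_edgesTo (X : Finset V) :
    cutSize G X = ∑ v ∈ X, edgesTo G v Xᶜ := by
  simp only [cutSize, edgesTo]
  rw [← Finset.card_sigma]
  refine Finset.card_bij' (fun p _ => ⟨p.1, p.2⟩) (fun p _ => (p.1, p.2)) ?_ ?_ ?_ ?_
  · simp; tauto
  · simp; tauto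
  · simp
  · simp

theorem levelDivisor_succ (D f : V → ℤ) (M : ℤ) (n : ℕ) :
    levelDivisor G D f M (n + 1) = fire G (levelDivisor G D f M n) (levelSet f M n) := by
  have h : (fun v => max (f v) (M - (n + 1 : ℕ))) = (fun v => max (f v) (M - n)) +
      (fun v => if v ∈ levelSet f M n then 1 else 0) + fun _ => -1 := by
    funext v
    simp only [levelSet, Finset.mem_filter, Finset.mem_univ, true_and, Pi.add_apply]
    split_ifs <;> push_cast <;> omega
  rw [fire_eq_sub_laplacian, levelDivisor, levelDivisor, h, laplacian_add, laplacian_add,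
    laplacian_const, add_zero, sub_sub]

theorem edgesTo_le_of_effective_fire {D : V → ℤ} {A : Finset V} (h : Effective (fire G D A))
    {v : V} (hv : v ∈ A) : (edgesTo G v Aᶜ : ℤ) ≤ D v := by
  simpa [fire, hv] using h v

theorem cutSize_le_degD {D : V → ℤ} {A : Finset V} (hD : Effective D)
    (h : Effective (fire G D A)) : (cutSize G A : ℤ) ≤ degD D := by
  rw [cutSize_eq_sum_edgesTo, Nat.cast_sum]
  exact (Finset.sum_le_sum fun v hv => edgesTo_le_of_effective_fire G h hv).trans
    (Finset.sum_le_sum_of_subset_of_nonneg (Finset.subset_univ A) fun v _ _ => hD v)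

/-- The eggs of `S` that contain a chip of `D`. -/
def hitEggs (S : Set (Finset V)) (D : V → ℤ) : Set (Finset V) := {E ∈ S | ∃ v ∈ E, 0 < D v}

variable {G} in
/-- An egg losing all its chips in a legal firing is contained in the fired set. -/
theorem subset_of_fire_unhit {D : V → ℤ} {A E : Finset V}
    (hE : (G.induce (E : Set V)).Connected) (hD : Effective D)
    (h0 : ∃ v ∈ E, 0 < D v) (h1 : ¬∃ v ∈ E, 0 < fire G D A v) : E ⊆ A := by
  obtain ⟨a, ha, hpos⟩ := h0
  have haA : a ∈ A := by
    by_contra haA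
    refine h1 ⟨a, ha, ?_⟩
    simp only [fire, haA, if_false]
    positivity
  intro b hb
  by_contra hbA
  obtain ⟨x, -, y, hyE, hxA, hyA, hxy⟩ := exists_adj_of_connected G hE ha haA hb hbA
  refine h1 ⟨y, hyE, ?_⟩
  have := edgesTo_pos G hxA hxy.symm
  have := hD y
  simp only [fire, hyA, if_false]
  omega

variable {G} in
/-- An egg gaining its first chip in a legal firing is disjoint from the fired set. -/
theorem subset_compl_of_fire_hit {D : V → ℤ} {A E : Finset V}
    (hE : (G.induce (E : Set V)).Connected) (hf : Effective (fire G D A))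
    (h0 : ¬∃ v ∈ E, 0 < D v) (h1 : ∃ v ∈ E, 0 < fire G D A v) : E ⊆ Aᶜ := by
  obtain ⟨b, hb, hpos⟩ := h1
  have hbA : b ∉ A := by
    intro hbA
    refine h0 ⟨b, hb, ?_⟩
    simp only [fire, hbA, if_true] at hpos
    omega
  intro a ha
  rw [Finset.mem_compl]
  intro haA
  obtain ⟨x, hxE, y, -, hxA, hyA, hxy⟩ := exists_adj_of_connected G hE ha haA hb hbA
  refine h0 ⟨x, hxE, ?_⟩
  have := edgesTo_pos G (Finset.mem_compl.2 hyA) hxy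
  have := edgesTo_le_of_effective_fire G hf hxA
  omega

variable {G} in
theorem exists_eggCut_of_hit_change {S : Set (Finset V)} (hS : IsScramble G S) {D f : V → ℤ}
    (hD : Effective D) (hf : Effective (D - laplacian G f)) {E E' : Finset V} {M : ℤ}
    (hM : ∀ v, f v ≤ M) (hE : E ∈ S) (hE' : E' ∈ S) {i : ℕ} (hED : ¬∃ v ∈ E, 0 < D v)
    (hi : ∃ v ∈ E, 0 < levelDivisor G D f M i v)
    (hmin : ∀ j < i, ¬∃ v ∈ E, 0 < levelDivisor G D f M j v)
    (hE'D : ∃ v ∈ E', 0 < D v) (hE'i : ¬∃ v ∈ E', 0 < levelDivisor G D f M i v) :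
    ∃ X, IsEggCut S X ∧ (cutSize G X : ℤ) ≤ degD D := by
  classical
  have heff := levelDivisor_effective G hD hf M
  have hz := levelDivisor_zero G (D := D) hM
  obtain _ | i := i
  · exact absurd (hz ▸ hi) hED
  have hex : ∃ j, ¬∃ v ∈ E', 0 < levelDivisor G D f M j v := ⟨_, hE'i⟩
  obtain ⟨j, hj⟩ : ∃ j, Nat.find hex = j + 1 := by
    refine Nat.exists_eq_succ_of_ne_zero fun h0 => ?_
    have := Nat.find_spec hex
    rw [h0, hz] at this
    exact this hE'D
  have hji : j ≤ i := by
    have := Nat.find_min' hex hE'i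
    omega
  have hjhit : ∃ v ∈ E', 0 < levelDivisor G D f M j v :=
    not_not.1 (Nat.find_min hex (by omega))
  have hjun := Nat.find_spec hex
  rw [hj, levelDivisor_succ] at hjun
  rw [levelDivisor_succ] at hi
  have hsucc : Effective (fire G (levelDivisor G D f M i) (levelSet f M i)) := by
    rw [← levelDivisor_succ]
    exact heff _
  refine ⟨levelSet f M i, ⟨⟨E', hE', ?_⟩, ⟨E, hE, ?_⟩⟩, ?_⟩
  · exact (subset_of_fire_unhit (hS E' hE').2 (heff j) hjhit hjun).trans (levelSet_mono f M hji)
  · exact subset_compl_of_fire_hit (hS E hE).2 hsucc (hmin i (by omega)) hi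
  · exact (cutSize_le_degD G (heff i) hsucc).trans_eq (degD_sub_laplacian G D _)

theorem degD_single (v : V) (c : ℤ) : degD (Pi.single v c) = c := by
  simp [degD]

theorem scrambleOrder_le_card {S : Set (Finset V)} {H : Finset V} (hH : IsHittingSet S H) :
    scrambleOrder G S ≤ H.card := by
  rw [scrambleOrder]
  exact min_le_of_left_le (sInf_le ⟨H, hH, rfl⟩)

theorem scrambleOrder_le_cutSize {S : Set (Finset V)} {X : Finset V} (hX : IsEggCut S X) :
    scrambleOrder G S ≤ cutSize G X := by
  rw [scrambleOrder]
  exact min_le_of_right_le (sInf_le ⟨X, hX, rfl⟩)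

variable {G} in
/-- The order of a scramble is at most the degree of any divisor of positive rank. -/
theorem scrambleOrder_le_of_rankGE_one [Nonempty V] {S : Set (Finset V)} (hS : IsScramble G S)
    {D₀ : V → ℤ} (hr : RankGE G D₀ 1) {d : ℕ} (hd : degD D₀ = d) :
    scrambleOrder G S ≤ d := by
  classical
  have hreach : ∀ v, ∃ f, Effective (D₀ - laplacian G f) ∧ 0 < (D₀ - laplacian G f) v := by
    intro v
    obtain ⟨D', h1, h2⟩ := hr (Pi.single v 1)
      (fun u => by by_cases h : u = v <;> simp [h]) (by simp [degD_single])
    obtain ⟨f, rfl⟩ := h1.exists_sub_laplacian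
    have hsplit : ∀ u, (D₀ - laplacian G f : V → ℤ) u =
        (D₀ - Pi.single v 1 - laplacian G f : V → ℤ) u + (Pi.single v 1 : V → ℤ) u := by
      intro u
      simp only [Pi.sub_apply]
      ring
    refine ⟨f, fun u => ?_, ?_⟩
    · rw [hsplit]
      have := h2 u
      by_cases h : u = v
      · subst h
        simp only [Pi.single_eq_same] at this ⊢
        omega
      · simpa [Pi.single_apply, h] using this
    · rw [hsplit]
      have := h2 v
      simp only [Pi.single_eq_same]
      omega
  obtain ⟨T, ⟨f₀, hf₀, rfl⟩, hmax⟩ := Set.Finite.exists_maximal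
    (s := {T | ∃ f, Effective (D₀ - laplacian G f) ∧ hitEggs S (D₀ - laplacian G f) = T})
    (Set.toFinite _) (by
      obtain ⟨v⟩ := ‹Nonempty V›
      obtain ⟨f, hf, -⟩ := hreach v
      exact ⟨_, f, hf, rfl⟩)
  have hdeg : degD (D₀ - laplacian G f₀) = d := by rw [degD_sub_laplacian, hd]
  set D := D₀ - laplacian G f₀ with hD
  by_cases hhit : ∀ E ∈ S, ∃ v ∈ E, 0 < D v
  · refine (scrambleOrder_le_card G (H := Finset.univ.filter fun v => 0 < D v)
      fun E hE => ?_).trans ?_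
    · obtain ⟨v, hv, hpos⟩ := hhit E hE
      exact ⟨v, by simp [hv, hpos]⟩
    · have : ((Finset.univ.filter fun v => 0 < D v).card : ℤ) ≤ d := by
        rw [← hdeg, Finset.card_filter, Nat.cast_sum]
        refine Finset.sum_le_sum fun v _ => ?_
        have := hf₀ v
        split_ifs <;> push_cast <;> omega
      exact_mod_cast this
  · push Not at hhit
    obtain ⟨E, hE, hEun⟩ := hhit
    have hEun' : ¬∃ v ∈ E, 0 < D v := by
      push Not
      exact hEun
    obtain ⟨v, hv⟩ := (hS E hE).1
    obtain ⟨g, hg, hgv⟩ := hreach v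
    have hrel : ∀ h : V → ℤ, D - laplacian G h = D₀ - laplacian G (f₀ + h) := by
      intro h
      rw [laplacian_add, hD, sub_sub]
    set f : V → ℤ := g - f₀ with hfdef
    have hDf : D - laplacian G f = D₀ - laplacian G g := by
      rw [hrel, hfdef, add_sub_cancel]
    rw [← hDf] at hg hgv
    obtain ⟨M, hM⟩ := (Set.finite_range f).bddAbove
    obtain ⟨m, hm⟩ := (Set.finite_range f).bddBelow
    replace hM : ∀ v, f v ≤ M := fun v => hM ⟨v, rfl⟩
    replace hm : ∀ v, m ≤ f v := fun v => hm ⟨v, rfl⟩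
    have hex : ∃ i, ∃ v ∈ E, 0 < levelDivisor G D f M i v := by
      refine ⟨(M - m).toNat, v, hv, ?_⟩
      rw [levelDivisor_of_le]
      · exact hgv
      · intro u
        have := hm u
        omega
    set i := Nat.find hex
    have hi : ∃ v ∈ E, 0 < levelDivisor G D f M i v := Nat.find_spec hex
    obtain ⟨E', hE', hE'i⟩ : ∃ E' ∈ hitEggs S D, E' ∉ hitEggs S (levelDivisor G D f M i) := by
      by_contra hcon
      push Not at hcon
      have hle := hmax ⟨_, by
        rw [← hrel]
        exact levelDivisor_effective G hf₀ hg M i, by rw [← hrel]; rfl⟩ hcon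
      exact hEun' (hle (show E ∈ hitEggs S (levelDivisor G D f M i) from ⟨hE, hi⟩)).2
    obtain ⟨X, hX, hXd⟩ := exists_eggCut_of_hit_change hS hf₀ hg hM hE hE'.1 hEun' hi
      (fun j hj => Nat.find_min hex hj) hE'.2 fun h => hE'i ⟨hE'.1, h⟩
    refine (scrambleOrder_le_cutSize G hX).trans ?_
    rw [hdeg] at hXd
    exact_mod_cast hXd

theorem exists_eq_single_of_degD_eq_one {E : V → ℤ} (hE : Effective E) (h : degD E = 1) :
    ∃ v, E = Pi.single v 1 := by
  obtain ⟨v, hv⟩ : ∃ v, 0 < E v := by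
    by_contra! hcon
    have : degD E ≤ 0 := Finset.sum_nonpos fun v _ => hcon v
    omega
  have hsum := Finset.add_sum_erase Finset.univ E (Finset.mem_univ v)
  have hnn : 0 ≤ ∑ u ∈ Finset.univ.erase v, E u := Finset.sum_nonneg fun u _ => hE u
  have hzero : ∑ u ∈ Finset.univ.erase v, E u = 0 := by
    rw [degD] at h
    omega
  refine ⟨v, funext fun u => ?_⟩
  by_cases hu : u = v
  · subst hu
    rw [degD] at h
    rw [Pi.single_eq_same]
    omega
  · rw [Pi.single_eq_of_ne hu]
    exact (Finset.sum_eq_zero_iff_of_nonneg fun u _ => hE u).1 hzero u (by simp [hu])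

end Laplacian

section Rook

theorem rook_adj {n m : ℕ} {p q : Fin n × Fin m} :
    (rook n m).Adj p q ↔ p.1 ≠ q.1 ∧ p.2 = q.2 ∨ p.2 ≠ q.2 ∧ p.1 = q.1 := by
  simp [rook, SimpleGraph.boxProd_adj]

/-- The columns occupied by `X` in row `i`. -/
def rowSet {n m : ℕ} (X : Finset (Fin n × Fin m)) (i : Fin n) : Finset (Fin m) :=
  Finset.univ.filter fun a => (i, a) ∈ X

/-- The rows occupied by `X` in column `a`. -/
def colSet {n m : ℕ} (X : Finset (Fin n × Fin m)) (a : Fin m) : Finset (Fin n) :=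
  Finset.univ.filter fun i => (i, a) ∈ X

theorem card_eq_sum_rowSet {n m : ℕ} (X : Finset (Fin n × Fin m)) :
    X.card = ∑ i, (rowSet X i).card := by
  simp only [rowSet, Finset.card_filter]
  rw [← Fintype.sum_prod_type' (f := fun i a => if (i, a) ∈ X then 1 else 0)]
  simp

theorem edgesTo_rook_compl {n m : ℕ} {X : Finset (Fin n × Fin m)} {v : Fin n × Fin m}
    (hv : v ∈ X) : edgesTo (rook n m) v Xᶜ = (rowSet X v.1)ᶜ.card + (colSet X v.2)ᶜ.card := by
  obtain ⟨i, a⟩ := v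
  rw [← Finset.card_disjSum, edgesTo]
  symm
  refine Finset.card_bij (fun s _ => Sum.elim (fun b => (i, b)) (fun j => (j, a)) s) ?_ ?_ ?_
  · rintro (b | j) h
    · have hb : (i, b) ∉ X := by simpa [rowSet] using h
      have : a ≠ b := by rintro rfl; exact hb hv
      simp [rook_adj, hb, this]
    · have hb : (j, a) ∉ X := by simpa [colSet] using h
      have : i ≠ j := by rintro rfl; exact hb hv
      simp [rook_adj, hb, this]
  · rintro (b | j) h (b' | j') h' heq
    · simpa using heq
    · have hb : (i, b) ∉ X := by simpa [rowSet] using h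
      simp only [Sum.elim_inl, Sum.elim_inr, Prod.mk.injEq] at heq
      rw [heq.2] at hb
      exact absurd hv hb
    · have hb : (j, a) ∉ X := by simpa [colSet] using h
      simp only [Sum.elim_inl, Sum.elim_inr, Prod.mk.injEq] at heq
      rw [heq.1] at hb
      exact absurd hv hb
    · simpa using heq
  · rintro ⟨j, b⟩ h
    simp only [Finset.mem_filter, Finset.mem_compl, rook_adj] at h
    obtain ⟨hX, ⟨-, h⟩ | ⟨-, h⟩⟩ := h
    · subst h
      exact ⟨Sum.inr j, by simpa [colSet] using hX, rfl⟩
    · subst h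
      exact ⟨Sum.inl b, by simpa [rowSet] using hX, rfl⟩

theorem cutSize_rook {n m : ℕ} (X : Finset (Fin n × Fin m)) :
    cutSize (rook n m) X = ∑ i, (rowSet X i).card * (rowSet X i)ᶜ.card +
      ∑ a, (colSet X a).card * (colSet X a)ᶜ.card := by
  rw [cutSize_eq_sum_edgesTo, Finset.sum_congr rfl fun v hv => edgesTo_rook_compl hv,
    Finset.sum_add_distrib]
  have h (g : Fin n × Fin m → ℕ) : ∑ v ∈ X, g v = ∑ v, if v ∈ X then g v else 0 := by
    simp
  congr 1
  · rw [h, Fintype.sum_prod_type]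
    refine Finset.sum_congr rfl fun i _ => ?_
    simp [← Finset.sum_filter, rowSet]
  · rw [h, Fintype.sum_prod_type_right]
    refine Finset.sum_congr rfl fun a _ => ?_
    simp [← Finset.sum_filter, colSet]

/-- Column edges of a cut: twice the columns met by `X` in row `i` but not in row `j`. -/
theorem two_mul_card_sdiff_le {m : ℕ} (X : Finset (Fin 3 × Fin m)) (i j : Fin 3) :
    2 * (rowSet X i \ rowSet X j).card ≤ ∑ a, (colSet X a).card * (colSet X a)ᶜ.card := by
  rw [mul_comm, ← smul_eq_mul]
  refine (Finset.card_nsmul_le_sum _ (fun a => (colSet X a).card * (colSet X a)ᶜ.card) 2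
    fun a ha => ?_).trans (Finset.sum_le_sum_of_subset (Finset.subset_univ _))
  simp only [rowSet, Finset.mem_sdiff, Finset.mem_filter, Finset.mem_univ, true_and] at ha
  have h1 : 0 < (colSet X a).card := Finset.card_pos.2 ⟨i, by simpa [colSet] using ha.1⟩
  have h2 : 0 < (colSet X a)ᶜ.card := Finset.card_pos.2 ⟨j, by simpa [colSet] using ha.2⟩
  have h3 := Finset.card_add_card_compl (colSet X a)
  rw [Fintype.card_fin] at h3
  obtain h | h : (colSet X a).card = 1 ∨ (colSet X a).card = 2 := by omega
  · rw [h] at h3 ⊢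
    omega
  · rw [h] at h3 ⊢
    omega

theorem two_mul_le_cutSize_rook_three {m : ℕ} (hm : 3 ≤ m) {X : Finset (Fin 3 × Fin m)}
    (h1 : 2 ≤ X.card) (h2 : 2 ≤ Xᶜ.card) : 2 * m ≤ cutSize (rook 3 m) X := by
  have hX := Finset.card_add_card_compl X
  have hK : ∀ i j, 2 * (rowSet X i).card ≤
      2 * (rowSet X j).card + ∑ a, (colSet X a).card * (colSet X a)ᶜ.card := by
    intro i j
    have := two_mul_card_sdiff_le X i j
    have := Finset.le_card_sdiff (rowSet X j) (rowSet X i)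
    omega
  rw [card_eq_sum_rowSet] at h1 hX
  rw [cutSize_rook]
  have hrow : ∀ i, ∃ p, (rowSet X i).card * (rowSet X i)ᶜ.card = p ∧ (rowSet X i).card ≤ m ∧
      ((rowSet X i).card = 0 ∨ (rowSet X i).card = m ∨ m ≤ p + 1) ∧
      (2 ≤ (rowSet X i).card → 2 * m ≤ p + 2 * (rowSet X i).card) ∧
      ((rowSet X i).card + 2 ≤ m → 2 * (rowSet X i).card ≤ p) := by
    intro i
    have h := Finset.card_add_card_compl (rowSet X i)
    rw [Fintype.card_fin] at h
    generalize (rowSet X i).card = r at *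
    generalize (rowSet X i)ᶜ.card = s at *
    subst h
    refine ⟨_, rfl, by omega, ?_, fun hr => ?_, fun hr => ?_⟩
    · rcases Nat.eq_zero_or_pos r with h | h
      · exact Or.inl h
      rcases Nat.eq_zero_or_pos s with h' | h'
      · right; left; omega
      · right; right; nlinarith
    · nlinarith
    · nlinarith
  obtain ⟨p0, e0, a0, b0, c0, d0⟩ := hrow 0
  obtain ⟨p1, e1, a1, b1, c1, d1⟩ := hrow 1
  obtain ⟨p2, e2, a2, b2, c2, d2⟩ := hrow 2
  have k01 := hK 0 1
  have k02 := hK 0 2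
  have k10 := hK 1 0
  have k12 := hK 1 2
  have k20 := hK 2 0
  have k21 := hK 2 1
  simp only [Fintype.card_prod, Fintype.card_fin] at hX
  rw [Fin.sum_univ_three] at hX h1 ⊢
  rw [e0, e1, e2]
  generalize ∑ a, (colSet X a).card * (colSet X a)ᶜ.card = K at *
  generalize (rowSet X 0).card = r0 at *
  generalize (rowSet X 1).card = r1 at *
  generalize (rowSet X 2).card = r2 at *
  clear e0 e1 e2 hK hrow
  omega

/-- The scramble whose eggs are the edges of a graph. -/
def edgeEggs {V : Type*} [DecidableEq V] (G : SimpleGraph V) : Set (Finset V) :=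
  {E | ∃ u v, G.Adj u v ∧ E = {u, v}}

theorem isScramble_edgeEggs {V : Type*} [DecidableEq V] (G : SimpleGraph V) :
    IsScramble G (edgeEggs G) := by
  rintro E ⟨u, v, h, rfl⟩
  refine ⟨⟨u, by simp⟩, ?_⟩
  rw [Finset.coe_pair]
  exact SimpleGraph.induce_pair_connected_of_adj h

theorem two_le_card_of_edgeEggs {V : Type*} [DecidableEq V] {G : SimpleGraph V} {E X : Finset V}
    (hE : E ∈ edgeEggs G) (h : E ⊆ X) : 2 ≤ X.card := by
  obtain ⟨u, v, huv, rfl⟩ := hE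
  rw [← Finset.card_pair huv.ne]
  exact Finset.card_le_card h

theorem card_compl_le_of_isHittingSet_edgeEggs {n m : ℕ} {H : Finset (Fin n × Fin m)}
    (hH : IsHittingSet (edgeEggs (rook n m)) H) : Hᶜ.card ≤ n := by
  have h := Finset.card_le_card_of_injOn (s := Hᶜ) (t := Finset.univ) Prod.fst (by simp) ?_
  · simpa using h
  · intro p hp q hq hpq
    by_contra hne
    have hadj : (rook n m).Adj p q := rook_adj.2 (Or.inr ⟨fun h => hne (Prod.ext hpq h), hpq⟩)
    obtain ⟨x, hx⟩ := hH _ ⟨p, q, hadj, rfl⟩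
    simp only [Finset.coe_compl, Set.mem_compl_iff, Finset.mem_coe] at hp hq
    simp only [Finset.mem_inter, Finset.mem_insert, Finset.mem_singleton] at hx
    obtain ⟨rfl | rfl, hx⟩ := hx
    exacts [hp hx, hq hx]

theorem two_mul_le_scrambleOrder_edgeEggs {m : ℕ} (hm : 3 ≤ m) :
    ((2 * m : ℕ) : ℕ∞) ≤ scrambleOrder (rook 3 m) (edgeEggs (rook 3 m)) := by
  refine le_min (le_sInf ?_) (le_sInf ?_)
  · rintro _ ⟨H, hH, rfl⟩
    have h1 := card_compl_le_of_isHittingSet_edgeEggs hH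
    have h2 := Finset.card_add_card_compl H
    simp only [Fintype.card_prod, Fintype.card_fin] at h2
    exact_mod_cast (by omega : 2 * m ≤ H.card)
  · rintro _ ⟨X, ⟨⟨E, hE, hEX⟩, ⟨E', hE', hEX'⟩⟩, rfl⟩
    exact_mod_cast two_mul_le_cutSize_rook_three hm (two_le_card_of_edgeEggs hE hEX)
      (two_le_card_of_edgeEggs hE' hEX')

/-- One chip on every vertex outside the last row. -/
def rookDivisor (m : ℕ) : Fin 3 × Fin m → ℤ := fun p => if p.1 = 2 then 0 else 1

theorem degD_rookDivisor (m : ℕ) : degD (rookDivisor m) = (2 * m : ℕ) := by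
  simp only [degD, rookDivisor, Fintype.sum_prod_type]
  rw [Fin.sum_univ_three]
  simp
  ring

theorem rankGE_rookDivisor (m : ℕ) : RankGE (rook 3 m) (rookDivisor m) 1 := by
  intro E hE hdeg
  obtain ⟨⟨i, a⟩, rfl⟩ := exists_eq_single_of_degD_eq_one hE (by simpa using hdeg)
  by_cases hi : i = 2
  · subst hi
    refine ⟨_, Relation.ReflTransGen.single
      ⟨Finset.univ.filter fun p : Fin 3 × Fin m => p.1 ≠ 2, rfl⟩, ?_⟩
    rintro ⟨j, b⟩
    by_cases hj : j = 2
    · subst hj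
      have h : 1 ≤ edgesTo (rook 3 m) (2, b) (Finset.univ.filter fun p => p.1 ≠ 2) :=
        edgesTo_pos _ (u := (0, b)) (by simp) (by simp [rook_adj])
      have h1 : (Pi.single (2, a) 1 : Fin 3 × Fin m → ℤ) (2, b) ≤ 1 := by
        rw [Pi.single_apply]
        split_ifs <;> simp
      simp only [fire, Finset.mem_filter, Finset.mem_univ, true_and, ne_eq, not_true_eq_false,
        if_false, Pi.sub_apply, rookDivisor, if_true] at h ⊢
      omega
    · have h : edgesTo (rook 3 m) (j, b) (Finset.univ.filter fun p => p.1 ≠ 2)ᶜ ≤ 1 := by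
        refine (Finset.card_le_card (t := {(2, b)}) ?_).trans_eq (Finset.card_singleton _)
        rintro ⟨k, c⟩ hk
        simp only [Finset.mem_filter, Finset.mem_compl, Finset.mem_univ, true_and, ne_eq,
          not_not, rook_adj] at hk
        obtain ⟨rfl, ⟨-, rfl⟩ | ⟨-, rfl⟩⟩ := hk
        · simp
        · exact absurd rfl hj
      have h1 : (Pi.single (2, a) 1 : Fin 3 × Fin m → ℤ) (j, b) = 0 := by
        simp [hj]
      simp only [fire, Finset.mem_filter, Finset.mem_univ, true_and, ne_eq, hj,
        not_false_eq_true, if_true, Pi.sub_apply, rookDivisor, if_false, h1] at h ⊢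
      omega
  · refine ⟨_, Relation.ReflTransGen.refl, ?_⟩
    rintro ⟨j, b⟩
    simp only [Pi.sub_apply, Pi.single_apply, rookDivisor, Prod.mk.injEq]
    split_ifs <;> simp_all

end Rook

/-- For all `m ≥ 3`, the scramble number of `K_3 □ K_m` equals `2 * m`, and hence equals
its gonality. -/
theorem sn_rook_three (m : ℕ) (hm : 3 ≤ m) :
    scrambleNumber (rook 3 m) = ((2 * m : ℕ) : ℕ∞) ∧
    scrambleNumber (rook 3 m) = (gonality (rook 3 m) : ℕ∞) := by
  have : NeZero m := ⟨by omega⟩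
  have hmem : 2 * m ∈
      {d : ℕ | ∃ D : Fin 3 × Fin m → ℤ, RankGE (rook 3 m) D 1 ∧ degD D = (d : ℤ)} :=
    ⟨rookDivisor m, rankGE_rookDivisor m, degD_rookDivisor m⟩
  have hle : gonality (rook 3 m) ≤ 2 * m := Nat.sInf_le hmem
  obtain ⟨D, hD, hdeg⟩ := Nat.sInf_mem ⟨_, hmem⟩
  have hsn : scrambleNumber (rook 3 m) ≤ (gonality (rook 3 m) : ℕ∞) := by
    refine sSup_le ?_
    rintro _ ⟨S, hS, rfl⟩
    exact scrambleOrder_le_of_rankGE_one hS hD hdeg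
  have hge : ((2 * m : ℕ) : ℕ∞) ≤ scrambleNumber (rook 3 m) :=
    (two_mul_le_scrambleOrder_edgeEggs hm).trans (le_sSup ⟨_, isScramble_edgeEggs _, rfl⟩)
  have hle' : (gonality (rook 3 m) : ℕ∞) ≤ ((2 * m : ℕ) : ℕ∞) := by exact_mod_cast hle
  exact ⟨le_antisymm (hsn.trans hle') hge, le_antisymm hsn (hle'.trans hge)⟩
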